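/- Let U ⊆ ℝ^d be a nonempty compact set, let r > 0, and define Thick(U, r) = {z : dist(z, U) ≤ √d·r}. Define EG_r(U) as the set of points p ∈ U such that p is a nearest point of U to some grid point x ∈ (r·ℤ)^d ∩ Thick(U, r). Then for every x ∈ U there exists p ∈ EG_r(U) with ‖x − p‖ ≤ 2√d·r. -/

import Mathlib

/-- Every point of `ℝ^d` is within `√d * r` of a point of the grid `(r·ℤ)^d`. -/
theorem exists_grid_point_dist_le (d : ℕ) {r : ℝ} (hr : 0 < r)
    (x : EuclideanSpace ℝ (Fin d)) :
    ∃ g : EuclideanSpace ℝ (Fin d), (∀ i, ∃ k : ℤ, g i = (k : ℝ) * r) ∧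
      dist g x ≤ Real.sqrt d * r := by
  refine ⟨WithLp.toLp 2 fun i => (⌊x i / r⌋ : ℝ) * r, fun i => ⟨⌊x i / r⌋, rfl⟩, ?_⟩
  have hcoord : ∀ i, dist ((⌊x i / r⌋ : ℝ) * r) (x i) ^ 2 ≤ r ^ 2 := fun i => by
    have hlower := (le_div_iff₀ hr).1 (Int.floor_le (x i / r))
    have hupper := (div_lt_iff₀ hr).1 (Int.lt_floor_add_one (x i / r))
    rw [Real.dist_eq, sq_abs]
    exact sq_le_sq' (by linarith) (by linarith)
  rw [EuclideanSpace.dist_eq]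
  refine Real.sqrt_le_iff.2 ⟨by positivity, ?_⟩
  rw [mul_pow, Real.sq_sqrt d.cast_nonneg]
  exact (Finset.sum_le_sum fun i _ => hcoord i).trans_eq (by simp)

/-- For a nonempty compact U ⊆ ℝ^d, every point of U is within 2√d·r of a point of the
expanded r-grid points EG_r(U): the nearest points of U to grid points of (r·ℤ)^d lying in
Thick(U,r) = {z : dist(z,U) ≤ √d·r}. -/
theorem stmt_4 (d : ℕ) (r : ℝ) (hr : 0 < r)
    (U : Set (EuclideanSpace ℝ (Fin d))) (hU : U.Nonempty) (hUc : IsCompact U) :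
    ∀ x ∈ U, ∃ p ∈ U,
      (∃ g : EuclideanSpace ℝ (Fin d), (∀ i, ∃ k : ℤ, g i = (k : ℝ) * r) ∧
        Metric.infDist g U ≤ Real.sqrt d * r ∧ dist g p = Metric.infDist g U) ∧
      dist x p ≤ 2 * Real.sqrt d * r := by
  intro x hx
  obtain ⟨g, hgrid, hgx⟩ := exists_grid_point_dist_le d hr x
  obtain ⟨p, hp, hgp⟩ := hUc.exists_infDist_eq_dist hU g
  have hle : Metric.infDist g U ≤ Real.sqrt d * r :=
    (Metric.infDist_le_dist_of_mem hx).trans hgx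
  refine ⟨p, hp, ⟨g, hgrid, hle, hgp.symm⟩, ?_⟩
  linarith [dist_triangle_left x p g]
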